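/- Every finite linear 3-graph with at least one vertex in which every vertex has degree at least 4 contains a crown. -/

import Mathlib

/-- `E` is (the edge set of) a linear 3-graph: every edge has 3 vertices and
any two distinct edges intersect in at most one vertex. -/
def LinearTripleSystem {V : Type*} [DecidableEq V] (E : Finset (Finset V)) : Prop :=
  (∀ e ∈ E, e.card = 3) ∧ ∀ e ∈ E, ∀ f ∈ E, e ≠ f → (e ∩ f).card ≤ 1

/-- `E` contains a crown: three pairwise disjoint edges (jewels) together with a
base edge intersecting all three jewels. -/
def HasCrown {V : Type*} [DecidableEq V] (E : Finset (Finset V)) : Prop :=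
  ∃ base ∈ E, ∃ j1 ∈ E, ∃ j2 ∈ E, ∃ j3 ∈ E,
    Disjoint j1 j2 ∧ Disjoint j1 j3 ∧ Disjoint j2 j3 ∧
    (base ∩ j1).Nonempty ∧ (base ∩ j2).Nonempty ∧ (base ∩ j3).Nonempty

/-- The degree of a vertex: the number of edges containing it. -/
def degree {V : Type*} [DecidableEq V] (E : Finset (Finset V)) (v : V) : ℕ :=
  (E.filter (fun e => v ∈ e)).card

/-- `List.foldr`, defined by the recursor so that the kernel evaluates it quickly. -/
noncomputable def recFoldr {α β : Type} (f : α → β → β) (b : β) (l : List α) : β :=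
  List.rec b (fun a _ ih => f a ih) l

/-- `cond`, defined by the recursor so that the kernel evaluates it quickly. -/
noncomputable def recCond {β : Type} (c : Bool) (x y : β) : β :=
  Bool.rec y x c

/-- `List.any` in terms of `recFoldr`. -/
noncomputable def recAny {α : Type} (p : α → Bool) (l : List α) : Bool :=
  recFoldr (fun a ih => recCond (p a) true ih) false l

/-- `List.filter` in terms of `recFoldr`. -/
noncomputable def recFilter {α : Type} (p : α → Bool) (l : List α) : List α :=
  recFoldr (fun a ih => recCond (p a) (a :: ih) ih) [] l

/-- Whether the vertex sets coded by the bit masks `a` and `b` intersect. -/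
def meets (a b : ℕ) : Bool := Nat.ble 1 (Nat.land a b)

/-- Whether the vertex sets coded by the bit masks `a` and `b` are disjoint. -/
def avoids (a b : ℕ) : Bool := Nat.beq (Nat.land a b) 0

/-- The bit mask of `{x, y, z}`. -/
def tripleMask (x y z : ℕ) : ℕ :=
  Nat.lor (Nat.shiftLeft 1 x) (Nat.lor (Nat.shiftLeft 1 y) (Nat.shiftLeft 1 z))

/-- The masks in `L` that contain the vertex `v`. -/
noncomputable def edgesAt (L : List ℕ) (v : ℕ) : List ℕ :=
  recFilter (meets (Nat.shiftLeft 1 v)) L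

/-- Whether some mask in `L` contains `y`. -/
noncomputable def covers (L : List ℕ) (y : ℕ) : Bool := recAny (meets (Nat.shiftLeft 1 y)) L

/-- Prepend to `acc` all pairs `(b, p ∪ q)` such that `b`, `p`, `q` are masks in `f :: L`, one of
them is `f`, and `p`, `q` are disjoint and meet `b`. -/
noncomputable def addPartialCrowns (f : ℕ) (L : List ℕ) (acc : List (ℕ × ℕ)) : List (ℕ × ℕ) :=
  recFoldr (fun b acc =>
    recFoldr (fun q acc => recCond (avoids f q) ((b, Nat.lor f q) :: acc) acc)
      (recFoldr (fun q acc => recCond (Nat.ble b q)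
        (recCond (avoids b q) ((f, Nat.lor b q) :: acc) acc) acc) acc (recFilter (meets f) L))
      (recFilter (meets b) L)) acc (recFilter (meets f) L)

/-- The pairs `(b, p ∪ q)` where `b`, `p`, `q` are in `L` and `p`, `q` are disjoint and meet `b`. -/
noncomputable def partialCrowns (L : List ℕ) : List (ℕ × ℕ) :=
  List.rec [] (fun f L ih => addPartialCrowns f L ih) L

/-- Whether `f` is the third jewel of a crown whose other edges are given by a member of `D`. -/
noncomputable def isThirdJewel (D : List (ℕ × ℕ)) (f : ℕ) : Bool :=
  recAny (fun d => recCond (meets f d.1) (avoids f d.2) false) D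

/-- Whether there are pairwise disjoint masks in `P`, `Q` and `R`. -/
noncomputable def disjointChoice (P Q R : List ℕ) : Bool :=
  recAny (fun p => recAny (fun q => recCond (avoids p q)
    (recAny (fun r => recCond (avoids p r) (avoids q r) false) R) false) Q) P

/-- Run `p` on every mask `f` of a list, together with the list `neg` of excluded masks, to which
the masks before `f` have been added; then run `q` on the final list of excluded masks. -/
def branchAll (p : ℕ → List ℕ → Bool) (q : List ℕ → Bool) : List ℕ → List ℕ → Bool
  | [], neg => q neg
  | f :: C, neg => p f neg && branchAll p q C (f :: neg)

/-- Whether the known edges `L` and the excluded edges `neg` show that `{v, x, y}` with `x < y`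
is not a new edge, or `y ≤ x`. Here `D` is the list of partial crowns of `L`. -/
noncomputable def isPruned (L neg : List ℕ) (D : List (ℕ × ℕ)) (v x y : ℕ) : Bool :=
  recCond (Nat.ble y x) true <|
  recCond (covers (edgesAt L x) y) true <|
  recCond (isThirdJewel D (tripleMask v x y)) true <|
  recCond (disjointChoice (edgesAt L v) (edgesAt L x) (edgesAt L y)) true <|
  recAny (Nat.beq (tripleMask v x y)) neg

/-- The possible new edges `{v, x, y}` with `x` and `y` in `xs`, given the known edges `L` and the
excluded edges `neg`. -/
noncomputable def candidates (L neg : List ℕ) (D : List (ℕ × ℕ)) (v : ℕ) (xs : List ℕ) : List ℕ :=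
  recFoldr (fun x acc => recFoldr (fun y acc =>
    recCond (isPruned L neg D v x y) acc (tripleMask v x y :: acc)) acc xs) [] xs

/-- An exhaustive search, which returns `true` only if no crown-free linear 3-graph of minimum
degree at least four contains distinct vertices `0, …, n - 1` and all edges in `L`, but no edge in
`neg`. It takes the first vertex of degree at most three and tries all further edges through it. -/
noncomputable def refutes : ℕ → ℕ → List ℕ → List ℕ → Bool
  | 0, _, _, _ => false
  | k + 1, n, L, neg =>
    match (List.range n).find? fun v => Nat.blt (edgesAt L v).length 4 with
    | none => false
    | some v =>
      let xs := recFilter (fun x => recCond (Nat.beq x v) false !covers (edgesAt L v) x)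
        (List.range n)
      let D := partialCrowns L
      branchAll (fun f neg' => refutes k n (f :: L) neg')
        (fun neg' =>
          (xs.all fun x => isThirdJewel D (tripleMask v x n) ||
            refutes k (n + 1) (tripleMask v x n :: L) neg') &&
          (isThirdJewel D (tripleMask v n (n + 1)) ||
            refutes k (n + 2) (tripleMask v n (n + 1) :: L) neg'))
        (candidates L neg D v xs) neg

section Evaluation

theorem recFoldr_eq_foldr {α β : Type} (f : α → β → β) (b : β) (l : List α) :
    recFoldr f b l = l.foldr f b := by
  induction l with
  | nil => rfl
  | cons a l ih => rw [List.foldr_cons, ← ih]; rfl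

theorem recCond_eq_ite {β : Type} (c : Bool) (x y : β) :
    recCond c x y = if c then x else y := by
  cases c <;> rfl

theorem recAny_eq_any {α : Type} (p : α → Bool) (l : List α) : recAny p l = l.any p := by
  rw [recAny, recFoldr_eq_foldr]
  induction l with
  | nil => rfl
  | cons a l ih => rw [List.foldr_cons, ih, recCond_eq_ite, List.any_cons]; cases p a <;> rfl

theorem recFilter_eq_filter {α : Type} (p : α → Bool) (l : List α) :
    recFilter p l = l.filter p := by
  rw [recFilter, recFoldr_eq_foldr]
  induction l with
  | nil => rfl
  | cons a l ih => rw [List.foldr_cons, ih, recCond_eq_ite, List.filter_cons]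

theorem avoids_iff {a b : ℕ} : avoids a b = true ↔ ∀ i, a.testBit i → ¬ b.testBit i := by
  have h : avoids a b = true ↔ a &&& b = 0 := Nat.beq_eq ▸ Iff.rfl
  rw [h]
  constructor
  · intro h i ha hb
    have := congrArg (fun m => m.testBit i) h
    simp [ha, hb] at this
  · intro h
    apply Nat.eq_of_testBit_eq
    intro i
    have := h i
    simp_all

theorem meets_iff {a b : ℕ} : meets a b = true ↔ ∃ i, a.testBit i ∧ b.testBit i := by
  have h : meets a b = true ↔ ¬ avoids a b = true := by
    have h1 : meets a b = true ↔ 1 ≤ a &&& b := Nat.ble_eq ▸ Iff.rfl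
    have h2 : avoids a b = true ↔ a &&& b = 0 := Nat.beq_eq ▸ Iff.rfl
    rw [h1, h2]
    omega
  rw [h, avoids_iff]
  push Not
  rfl

theorem testBit_tripleMask {x y z i : ℕ} :
    (tripleMask x y z).testBit i = true ↔ i = x ∨ i = y ∨ i = z := by
  have h : tripleMask x y z = 1 <<< x ||| (1 <<< y ||| 1 <<< z) := rfl
  simp only [h, Nat.one_shiftLeft, Nat.testBit_or, Nat.testBit_two_pow, Bool.or_eq_true,
    decide_eq_true_eq, @eq_comm _ i]

theorem meets_shiftLeft_iff {v m : ℕ} :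
    meets (Nat.shiftLeft 1 v) m = true ↔ m.testBit v = true := by
  have h : Nat.shiftLeft 1 v = 2 ^ v := Nat.one_shiftLeft v
  rw [meets_iff, h]
  simp [Nat.testBit_two_pow]

theorem mem_edgesAt {L : List ℕ} {v m : ℕ} :
    m ∈ edgesAt L v ↔ m ∈ L ∧ m.testBit v = true := by
  rw [edgesAt, recFilter_eq_filter, List.mem_filter, meets_shiftLeft_iff]

theorem covers_iff {L : List ℕ} {y : ℕ} :
    covers L y = true ↔ ∃ m ∈ L, m.testBit y = true := by
  simp only [covers, recAny_eq_any, List.any_eq_true, meets_shiftLeft_iff]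

/-- The edges of `d = (b, p ∪ q)` are in `L`, and form a crown together with a third jewel. -/
def IsPartialCrown (L : List ℕ) (d : ℕ × ℕ) : Prop :=
  ∃ p ∈ L, ∃ q ∈ L, d.1 ∈ L ∧ d.2 = p ||| q ∧
    meets d.1 p = true ∧ meets d.1 q = true ∧ avoids p q = true

theorem isPartialCrown_addPartialCrowns {f : ℕ} {L : List ℕ} {acc : List (ℕ × ℕ)}
    (hacc : ∀ d ∈ acc, IsPartialCrown (f :: L) d) :
    ∀ d ∈ addPartialCrowns f L acc, IsPartialCrown (f :: L) d := by
  have comm {a b : ℕ} (h : meets a b = true) : meets b a = true := by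
    rw [meets_iff] at h ⊢
    simpa only [and_comm] using h
  simp only [addPartialCrowns, recFoldr_eq_foldr, recFilter_eq_filter, recCond_eq_ite]
  let P (acc : List (ℕ × ℕ)) : Prop := ∀ d ∈ acc, IsPartialCrown (f :: L) d
  refine List.foldrRecOn (motive := P) _ _ hacc fun acc hacc b hb => ?_
  rw [List.mem_filter] at hb
  refine List.foldrRecOn (motive := P) _ _
    (List.foldrRecOn (motive := P) _ _ hacc fun acc hacc q hq => ?_)
    fun acc hacc q hq => ?_ <;> rw [List.mem_filter] at hq
  · split_ifs with _ h
    · rintro d (_ | ⟨_, hd⟩)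
      · exact ⟨b, by simp [hb], q, by simp [hq], by simp, rfl, hb.2, hq.2, h⟩
      · exact hacc d hd
    all_goals exact hacc
  · split_ifs with h
    · rintro d (_ | ⟨_, hd⟩)
      · exact ⟨f, by simp, q, by simp [hq], by simp [hb], rfl, comm hb.2, hq.2, h⟩
      · exact hacc d hd
    · exact hacc

theorem isPartialCrown_of_mem {L : List ℕ} {d : ℕ × ℕ} (hd : d ∈ partialCrowns L) :
    IsPartialCrown L d := by
  induction L generalizing d with
  | nil => exact absurd hd List.not_mem_nil
  | cons f L ih =>
    refine isPartialCrown_addPartialCrowns (fun d hd => ?_) d hd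
    obtain ⟨p, hp, q, hq, hb, h⟩ := ih hd
    exact ⟨p, .tail _ hp, q, .tail _ hq, .tail _ hb, h⟩

theorem mem_candidates {L neg : List ℕ} {D : List (ℕ × ℕ)} {v f : ℕ} {xs : List ℕ} :
    f ∈ candidates L neg D v xs ↔
      ∃ x ∈ xs, ∃ y ∈ xs, isPruned L neg D v x y = false ∧ f = tripleMask v x y := by
  have inner (x : ℕ) (acc ys : List ℕ) :
      f ∈ ys.foldr (fun y acc => if isPruned L neg D v x y then acc
        else tripleMask v x y :: acc) acc ↔
      (∃ y ∈ ys, isPruned L neg D v x y = false ∧ f = tripleMask v x y) ∨ f ∈ acc := by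
    induction ys with
    | nil => simp
    | cons y ys ih => cases h : isPruned L neg D v x y <;> simp [h, ih, or_assoc]
  have outer (ys : List ℕ) :
      f ∈ ys.foldr (fun x acc => xs.foldr (fun y acc => if isPruned L neg D v x y then acc
        else tripleMask v x y :: acc) acc) [] ↔
      ∃ x ∈ ys, ∃ y ∈ xs, isPruned L neg D v x y = false ∧ f = tripleMask v x y := by
    induction ys with
    | nil => simp
    | cons x ys ih => rw [List.foldr_cons, inner, ih]; simp
  simpa only [candidates, recFoldr_eq_foldr, recCond_eq_ite] using outer xs

end Evaluation

section Realization

variable {V : Type*} [DecidableEq V]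

/-- The set of vertices coded by the mask `m` when the vertices are labelled by `φ`. -/
def vertexSet (φ : ℕ → V) (m : ℕ) : Finset V :=
  {i ∈ Finset.range m | m.testBit i = true}.image φ

theorem mem_vertexSet {φ : ℕ → V} {m : ℕ} {a : V} :
    a ∈ vertexSet φ m ↔ ∃ i, m.testBit i = true ∧ φ i = a := by
  simp only [vertexSet, Finset.mem_image, Finset.mem_filter, Finset.mem_range]
  refine exists_congr fun i => and_congr_left fun _ => and_iff_right_of_imp fun h => ?_
  exact i.lt_two_pow_self.trans_le (Nat.ge_two_pow_of_testBit h)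

theorem vertexSet_tripleMask (φ : ℕ → V) (x y z : ℕ) :
    vertexSet φ (tripleMask x y z) = {φ x, φ y, φ z} := by
  ext a
  simp only [mem_vertexSet, testBit_tripleMask, Finset.mem_insert, Finset.mem_singleton]
  grind

theorem vertexSet_congr {φ ψ : ℕ → V} {m : ℕ} (h : ∀ i, m.testBit i = true → φ i = ψ i) :
    vertexSet φ m = vertexSet ψ m := by
  ext a
  simp only [mem_vertexSet]
  exact exists_congr fun i => and_congr_right fun hi => by rw [h i hi]

/-- The labelling `φ` maps `0, …, n - 1` to distinct vertices, the masks in `L` to edges in `E`,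
and the masks in `neg` to sets that are not in `E`. -/
structure Realizes (E : Finset (Finset V)) (φ : ℕ → V) (n : ℕ) (L neg : List ℕ) : Prop where
  injOn : Set.InjOn φ (Set.Iio n)
  lt_of_mem : ∀ m ∈ L, ∀ i, m.testBit i = true → i < n
  lt_of_mem_neg : ∀ m ∈ neg, ∀ i, m.testBit i = true → i < n
  vertexSet_mem : ∀ m ∈ L, vertexSet φ m ∈ E
  vertexSet_notMem : ∀ m ∈ neg, vertexSet φ m ∉ E

namespace Realizes

variable {E : Finset (Finset V)} {φ : ℕ → V} {n : ℕ} {L neg : List ℕ}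

theorem cons (h : Realizes E φ n L neg) {f : ℕ} (hf : ∀ i, f.testBit i = true → i < n)
    (hE : vertexSet φ f ∈ E) : Realizes E φ n (f :: L) neg where
  injOn := h.injOn
  lt_of_mem := List.forall_mem_cons.2 ⟨hf, h.lt_of_mem⟩
  lt_of_mem_neg := h.lt_of_mem_neg
  vertexSet_mem := List.forall_mem_cons.2 ⟨hE, h.vertexSet_mem⟩
  vertexSet_notMem := h.vertexSet_notMem

theorem cons_neg (h : Realizes E φ n L neg) {f : ℕ} (hf : ∀ i, f.testBit i = true → i < n)
    (hE : vertexSet φ f ∉ E) : Realizes E φ n L (f :: neg) where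
  injOn := h.injOn
  lt_of_mem := h.lt_of_mem
  lt_of_mem_neg := List.forall_mem_cons.2 ⟨hf, h.lt_of_mem_neg⟩
  vertexSet_mem := h.vertexSet_mem
  vertexSet_notMem := List.forall_mem_cons.2 ⟨hE, h.vertexSet_notMem⟩

theorem update (h : Realizes E φ n L neg) {a : V} (ha : ∀ i < n, φ i ≠ a) :
    Realizes E (Function.update φ n a) (n + 1) L neg := by
  have hφ {i : ℕ} (hi : i < n) : Function.update φ n a i = φ i :=
    Function.update_of_ne hi.ne _ _
  have hset {m : ℕ} (hm : ∀ i, m.testBit i = true → i < n) :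
      vertexSet (Function.update φ n a) m = vertexSet φ m :=
    vertexSet_congr fun i hi => hφ (hm i hi)
  constructor
  · intro i hi j hj hij
    have hn : Function.update φ n a n = a := Function.update_self ..
    rcases Nat.lt_succ_iff_lt_or_eq.1 hi with hi | rfl <;>
      rcases Nat.lt_succ_iff_lt_or_eq.1 hj with hj | rfl
    · exact h.injOn hi hj (by rwa [hφ hi, hφ hj] at hij)
    · exact absurd (by rwa [hφ hi, hn] at hij) (ha i hi)
    · exact absurd (by rwa [hφ hj, hn, eq_comm] at hij) (ha j hj)
    · rfl
  · exact fun m hm i hi => (h.lt_of_mem m hm i hi).trans n.lt_succ_self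
  · exact fun m hm i hi => (h.lt_of_mem_neg m hm i hi).trans n.lt_succ_self
  · exact fun m hm => hset (h.lt_of_mem m hm) ▸ h.vertexSet_mem m hm
  · exact fun m hm => hset (h.lt_of_mem_neg m hm) ▸ h.vertexSet_notMem m hm

theorem testBit_of_mem_vertexSet (h : Realizes E φ n L neg) {m v : ℕ} (hm : m ∈ L) (hv : v < n)
    (hmem : φ v ∈ vertexSet φ m) : m.testBit v = true := by
  obtain ⟨i, hi, hiv⟩ := mem_vertexSet.1 hmem
  rwa [← h.injOn (h.lt_of_mem m hm i hi) hv hiv]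

theorem disjoint_vertexSet (h : Realizes E φ n L neg) {p q : ℕ} (hp : p ∈ L) (hq : q ∈ L)
    (hpq : avoids p q = true) : Disjoint (vertexSet φ p) (vertexSet φ q) := by
  rw [Finset.disjoint_left]
  intro a hap haq
  obtain ⟨i, hi, rfl⟩ := mem_vertexSet.1 hap
  exact avoids_iff.1 hpq i hi (h.testBit_of_mem_vertexSet hq (h.lt_of_mem p hp i hi) haq)

theorem hasCrown (h : Realizes E φ n L neg) {b p q r : ℕ} (hb : b ∈ L) (hp : p ∈ L) (hq : q ∈ L)
    (hr : r ∈ L) (hpq : avoids p q = true) (hpr : avoids p r = true) (hqr : avoids q r = true)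
    (hbp : meets b p = true) (hbq : meets b q = true) (hbr : meets b r = true) : HasCrown E := by
  have hmeet {p : ℕ} (hbp : meets b p = true) : (vertexSet φ b ∩ vertexSet φ p).Nonempty := by
    obtain ⟨i, hi, hi'⟩ := meets_iff.1 hbp
    exact ⟨φ i, Finset.mem_inter.2 ⟨mem_vertexSet.2 ⟨i, hi, rfl⟩, mem_vertexSet.2 ⟨i, hi', rfl⟩⟩⟩
  exact ⟨_, h.vertexSet_mem b hb, _, h.vertexSet_mem p hp, _, h.vertexSet_mem q hq,
    _, h.vertexSet_mem r hr, h.disjoint_vertexSet hp hq hpq, h.disjoint_vertexSet hp hr hpr,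
    h.disjoint_vertexSet hq hr hqr, hmeet hbp, hmeet hbq, hmeet hbr⟩

theorem hasCrown_of_isThirdJewel {f : ℕ} (h : Realizes E φ n (f :: L) neg)
    (hf : isThirdJewel (partialCrowns L) f = true) : HasCrown E := by
  simp only [isThirdJewel, recAny_eq_any, List.any_eq_true, recCond_eq_ite] at hf
  obtain ⟨⟨b, s⟩, hd, hf⟩ := hf
  obtain ⟨p, hp, q, hq, hb, rfl, hbp, hbq, hpq⟩ := isPartialCrown_of_mem hd
  split_ifs at hf with hfb
  rw [avoids_iff] at hf
  refine h.hasCrown (b := b) (p := p) (q := q) (r := f) (.tail _ hb) (.tail _ hp) (.tail _ hq)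
    (.head _) hpq ?_ ?_ hbp hbq ?_
  · exact avoids_iff.2 fun i hi hi' => hf i hi' (by simp [hi])
  · exact avoids_iff.2 fun i hi hi' => hf i hi' (by simp [hi])
  · rw [meets_iff] at hfb ⊢
    simpa only [and_comm] using hfb

theorem hasCrown_of_disjointChoice {v x y : ℕ} (h : Realizes E φ n (tripleMask v x y :: L) neg)
    (hc : disjointChoice (edgesAt L v) (edgesAt L x) (edgesAt L y) = true) : HasCrown E := by
  simp only [disjointChoice, recAny_eq_any, List.any_eq_true, recCond_eq_ite] at hc
  obtain ⟨p, hp, q, hq, hc⟩ := hc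
  split_ifs at hc with hpq
  simp only [List.any_eq_true] at hc
  obtain ⟨r, hr, hc⟩ := hc
  split_ifs at hc with hpr
  rw [mem_edgesAt] at hp hq hr
  refine h.hasCrown (.head _) (.tail _ hp.1) (.tail _ hq.1) (.tail _ hr.1) hpq hpr hc ?_ ?_ ?_
  · exact meets_iff.2 ⟨v, by simp [testBit_tripleMask], hp.2⟩
  · exact meets_iff.2 ⟨x, by simp [testBit_tripleMask], hq.2⟩
  · exact meets_iff.2 ⟨y, by simp [testBit_tripleMask], hr.2⟩

/-- If every branch of `branchAll` is refuted, then no branch edge is in `E`, and the last branch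
is reached. -/
theorem of_branchAll {p : ℕ → List ℕ → Bool} {q : List ℕ → Bool} {C : List ℕ}
    (h : Realizes E φ n L neg) (hb : branchAll p q C neg = true)
    (hC : ∀ f ∈ C, ∀ i, f.testBit i = true → i < n)
    (hp : ∀ f ∈ C, ∀ neg, Realizes E φ n (f :: L) neg → p f neg = true → False) :
    (∀ f ∈ C, vertexSet φ f ∉ E) ∧ ∃ neg, Realizes E φ n L neg ∧ q neg = true := by
  induction C generalizing neg with
  | nil => exact ⟨by simp, neg, h, hb⟩
  | cons f C ih =>
    simp only [branchAll, Bool.and_eq_true] at hb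
    rw [List.forall_mem_cons] at hC hp ⊢
    have hf : vertexSet φ f ∉ E := fun hf => hp.1 neg (h.cons hC.1 hf) hb.1
    have := ih (h.cons_neg hC.1 hf) hb.2 hC.2 hp.2
    exact ⟨⟨hf, this.1⟩, this.2⟩

/-- A vertex with at most three known edges lies on a further edge, which meets every known edge
in at most one vertex. -/
theorem exists_new_edge (h : Realizes E φ n L neg) (hlin : LinearTripleSystem E)
    (hdeg : ∀ v : V, 4 ≤ degree E v) {v : ℕ} (hv : v < n) (hL : (edgesAt L v).length < 4) :
    ∃ a b, a ≠ φ v ∧ b ≠ φ v ∧ a ≠ b ∧ {φ v, a, b} ∈ E ∧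
      ∀ m ∈ L, (vertexSet φ m ∩ {φ v, a, b}).card ≤ 1 := by
  have hcard : ((edgesAt L v).toFinset.image (vertexSet φ)).card <
      (E.filter (fun e => φ v ∈ e)).card :=
    (Finset.card_image_le.trans (List.toFinset_card_le _)).trans_lt (hL.trans_le (hdeg (φ v)))
  obtain ⟨e, he, he'⟩ := Finset.exists_mem_notMem_of_card_lt_card hcard
  rw [Finset.mem_filter] at he
  have hne : ∀ m ∈ L, vertexSet φ m ≠ e := by
    rintro m hm rfl
    refine he' (Finset.mem_image_of_mem _ (List.mem_toFinset.2 (mem_edgesAt.2 ⟨hm, ?_⟩)))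
    exact h.testBit_of_mem_vertexSet hm hv he.2
  have hcard : (e.erase (φ v)).card = 2 := by
    rw [Finset.card_erase_of_mem he.2, hlin.1 e he.1]
  obtain ⟨a, b, hab, hs⟩ := Finset.card_eq_two.1 hcard
  have heq : e = {φ v, a, b} := by rw [← Finset.insert_erase he.2, hs]
  have ha : a ∈ e.erase (φ v) := by simp [hs]
  have hb : b ∈ e.erase (φ v) := by simp [hs]
  refine ⟨a, b, Finset.ne_of_mem_erase ha, Finset.ne_of_mem_erase hb, hab, heq ▸ he.1, ?_⟩
  exact fun m hm => heq ▸ hlin.2 _ (h.vertexSet_mem m hm) e he.1 (hne m hm)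

end Realizes

theorem not_refutes {E : Finset (Finset V)} (hlin : LinearTripleSystem E)
    (hdeg : ∀ v : V, 4 ≤ degree E v) (hcrown : ¬ HasCrown E) {k n : ℕ} {L neg : List ℕ}
    {φ : ℕ → V} (h : Realizes E φ n L neg) : ¬ refutes k n L neg = true := by
  induction k generalizing n L neg φ with
  | zero => simp [refutes]
  | succ k ih =>
    intro href
    rw [refutes] at href
    split at href
    · simp at href
    rename_i v hfind
    have hv : v < n := List.mem_range.1 (List.mem_of_find?_eq_some hfind)
    have hL : (edgesAt L v).length < 4 := by
      simpa [Nat.blt_eq] using List.find?_some hfind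
    dsimp only at href
    generalize hxs : recFilter _ (List.range n) = xs at href
    have mem_xs {x : ℕ} : x ∈ xs ↔ x < n ∧ x ≠ v ∧ covers (edgesAt L v) x = false := by
      rw [← hxs, recFilter_eq_filter, List.mem_filter, List.mem_range, recCond_eq_ite]
      by_cases hxv : x = v <;> simp [hxv]
    have triple_lt {n x y z : ℕ} (hx : x < n) (hy : y < n) (hz : z < n) :
        ∀ i, (tripleMask x y z).testBit i = true → i < n := by
      intro i hi
      rcases testBit_tripleMask.1 hi with rfl | rfl | rfl <;> assumption
    obtain ⟨hknown, neg', h', hq⟩ := h.of_branchAll href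
      (fun f hf => by
        obtain ⟨x, hx, y, hy, -, rfl⟩ := mem_candidates.1 hf
        exact triple_lt hv (mem_xs.1 hx).1 (mem_xs.1 hy).1)
      (fun f _ neg hr => ih hr)
    simp only [Bool.and_eq_true, List.all_eq_true, Bool.or_eq_true] at hq
    obtain ⟨a, b, hav, hbv, hab, hE, hmeet⟩ := h.exists_new_edge hlin hdeg hv hL
    have hcov {x y : ℕ} (hx : φ x ∈ ({φ v, a, b} : Finset V))
        (hy : φ y ∈ ({φ v, a, b} : Finset V)) (hxy : φ x ≠ φ y) :
        covers (edgesAt L x) y = false := by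
      rw [← Bool.not_eq_true, covers_iff]
      rintro ⟨m, hm, hmy⟩
      rw [mem_edgesAt] at hm
      refine hxy (Finset.card_le_one.1 (hmeet m hm.1) _ ?_ _ ?_) <;>
        rw [Finset.mem_inter, mem_vertexSet]
      · exact ⟨⟨x, hm.2, rfl⟩, hx⟩
      · exact ⟨⟨y, hmy, rfl⟩, hy⟩
    have hmem {x : ℕ} (hx : x < n) (hxe : φ x ∈ ({φ v, a, b} : Finset V)) (hxv : φ x ≠ φ v) :
        x ∈ xs :=
      mem_xs.2 ⟨hx, fun h => hxv (h ▸ rfl), hcov (by simp) hxe hxv.symm⟩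
    have hnew {ψ : ℕ → V} {n' : ℕ} {f : ℕ} (hr : Realizes E ψ n' (f :: L) neg')
        (hf : isThirdJewel (partialCrowns L) f = true ∨ refutes k n' (f :: L) neg' = true) :
        False :=
      hf.elim (fun hf => hcrown (hr.hasCrown_of_isThirdJewel hf)) (ih hr)
    -- The new edge has exactly one vertex besides `φ v` that is known.
    have hone {x : ℕ} {c : V} (hx : x < n) (hxe : φ x ∈ ({φ v, a, b} : Finset V))
        (hxv : φ x ≠ φ v) (hc : ∀ i < n, φ i ≠ c) (he : {φ v, φ x, c} ∈ E) : False := by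
      refine hnew ((h'.update hc).cons (triple_lt (hv.trans n.lt_succ_self)
        (hx.trans n.lt_succ_self) n.lt_succ_self) ?_) (hq.1 x (hmem hx hxe hxv))
      rwa [vertexSet_tripleMask, Function.update_of_ne hv.ne, Function.update_of_ne hx.ne,
        Function.update_self]
    -- All vertices of the new edge are known.
    have htwo {x y : ℕ} (hxy : x < y) (hy : y < n) (hxv : φ x ≠ φ v) (hyv : φ y ≠ φ v)
        (he : ({φ v, φ x, φ y} : Finset V) = {φ v, a, b}) : False := by
      have hx : x < n := hxy.trans hy
      have hxe : φ x ∈ ({φ v, a, b} : Finset V) := he ▸ by simp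
      have hye : φ y ∈ ({φ v, a, b} : Finset V) := he ▸ by simp
      have hxy' : φ x ≠ φ y := fun h' => hxy.ne (h.injOn hx hy h')
      have hfE : vertexSet φ (tripleMask v x y) ∈ E := by rwa [vertexSet_tripleMask, he]
      have hr := h.cons (triple_lt hv hx hy) hfE
      refine hknown _ (mem_candidates.2 ⟨x, hmem hx hxe hxv, y, hmem hy hye hyv, ?_, rfl⟩) hfE
      have h1 : Nat.ble y x = false := by
        rw [← Bool.not_eq_true, Nat.ble_eq]
        omega
      have h2 : isThirdJewel (partialCrowns L) (tripleMask v x y) = false :=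
        Bool.eq_false_iff.2 fun hf => hcrown (hr.hasCrown_of_isThirdJewel hf)
      have h3 : disjointChoice (edgesAt L v) (edgesAt L x) (edgesAt L y) = false :=
        Bool.eq_false_iff.2 fun hf => hcrown (hr.hasCrown_of_disjointChoice hf)
      simp only [isPruned, recCond_eq_ite, h1, h2, h3, hcov hxe hye hxy', recAny_eq_any]
      simp only [Bool.false_eq_true, if_false, List.any_eq_false, Nat.beq_eq]
      rintro m hm rfl
      exact h.vertexSet_notMem _ hm hfE
    by_cases ha : ∀ i < n, φ i ≠ a <;> by_cases hb : ∀ i < n, φ i ≠ b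
    · have hb' : ∀ i < n + 1, Function.update φ n a i ≠ b := by
        intro i hi
        rcases Nat.lt_succ_iff_lt_or_eq.1 hi with hi | rfl
        · rw [Function.update_of_ne hi.ne]
          exact hb i hi
        · rwa [Function.update_self]
      refine hnew (((h'.update ha).update hb').cons (triple_lt (by omega) (by omega) (by omega)) ?_)
        hq.2
      rwa [vertexSet_tripleMask, Function.update_self, Function.update_of_ne (by omega),
        Function.update_of_ne (by omega), Function.update_of_ne (by omega), Function.update_self]
    · push Not at hb
      obtain ⟨y, hy, rfl⟩ := hb
      exact hone hy (by simp) hbv ha (by rwa [Finset.pair_comm])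
    · push Not at ha
      obtain ⟨x, hx, rfl⟩ := ha
      exact hone hx (by simp) hav hb hE
    · push Not at ha hb
      obtain ⟨x, hx, rfl⟩ := ha
      obtain ⟨y, hy, rfl⟩ := hb
      rcases lt_trichotomy x y with hxy | rfl | hxy
      · exact htwo hxy hy hav hbv rfl
      · exact hab rfl
      · exact htwo hxy hx hbv hav (by rw [Finset.pair_comm])

end Realization

theorem refutes_one_vertex : refutes 15 1 [] [] = true := by
  decide +kernel

/-- Every finite linear 3-graph with at least one vertex in which every vertex has
degree at least 4 contains a crown. -/
theorem mindeg_four_hasCrown {V : Type*} [Fintype V] [Nonempty V] [DecidableEq V]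
    (E : Finset (Finset V)) (hlin : LinearTripleSystem E)
    (hdeg : ∀ v : V, 4 ≤ degree E v) : HasCrown E := by
  by_contra hcrown
  have h : Realizes E (fun _ => Classical.arbitrary V) 1 [] [] := by
    constructor
    · intro i hi j hj _
      simp_all
    all_goals simp
  exact not_refutes hlin hdeg hcrown h refutes_one_vertex
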